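/- arXiv:2404.17540 — 6 statements merged into one kernel-verified Lean document; each statement's English description precedes it below -/
import Mathlib

section
/- Let n ≥ 4 and let i, j, k, l ∈ {1,...,n} be pairwise distinct with i < j and k < l. Set i′ = ρ^n_{k,l}(i), j′ = ρ^n_{k,l}(j), k′ = ρ^n_{i,j}(k), l′ = ρ^n_{i,j}(l); then i′ < j′ ≤ n−2 and k′ < l′ ≤ n−2, and the following identity holds in S_n: ρ^{n−2}_{k′,l′} ∘ ρ^n_{i,j} = (n−1, n−3)(n−2, n) ∘ ρ^{n−2}_{i′,j′} ∘ ρ^n_{k,l}, where ρ^{n−2} denotes the corresponding permutation of {1,...,n−2} regarded as an element of S_n fixing n−1 and n, and (n−1, n−3)(n−2, n) is the product of the two indicated transpositions. -/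
/-- ε_{a,b}(c): 0 if c < a, 1 if a < c < b, 2 if b < c (for c ∉ {a,b}, a < b). -/
def eps (a b c : ℕ) : ℕ := if c < a then 0 else if c < b then 1 else 2

/-- ρ^n_{i,j} : sends i ↦ n−1, j ↦ n, and k ↦ k − ε_{i,j}(k) otherwise. -/
def rho (n i j k : ℕ) : ℕ := if k = i then n - 1 else if k = j then n else k - eps i j k

/-- The inverse of ρ^n_{i,j} on {1,...,n}. -/
noncomputable def rhoInv (n i j c : ℕ) : ℕ := Function.invFunOn (rho n i j) (Set.Icc 1 n) c

/-- ρ^n_{i,j} extended by the identity outside {1,...,n}, viewed as a map ℕ → ℕ. -/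
def rhoE (n i j k : ℕ) : ℕ := if 1 ≤ k ∧ k ≤ n then rho n i j k else k

/-- A map ℕ → ℕ which restricts to a permutation of S and is the identity off S. -/
def PermOn (S : Set ℕ) (f : ℕ → ℕ) : Prop := Set.BijOn f S S ∧ ∀ x ∉ S, f x = x

/-- Membership in O_n: 1 ≤ a < b ≤ n and 1 ≤ c < d ≤ n−2. -/
def memO (n a b c d : ℕ) : Prop := 1 ≤ a ∧ a < b ∧ b ≤ n ∧ 1 ≤ c ∧ c < d ∧ d ≤ n - 2

/-- The involution ι_n on O_n: ι_n(a,b,c,d) = (k, l, ρ_{k,l}(a), ρ_{k,l}(b)) where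
k = ρ_{a,b}⁻¹(c), l = ρ_{a,b}⁻¹(d). -/
noncomputable def iota (n : ℕ) (t : ℕ × ℕ × ℕ × ℕ) : ℕ × ℕ × ℕ × ℕ :=
  (rhoInv n t.1 t.2.1 t.2.2.1, rhoInv n t.1 t.2.1 t.2.2.2,
    rho n (rhoInv n t.1 t.2.1 t.2.2.1) (rhoInv n t.1 t.2.1 t.2.2.2) t.1,
    rho n (rhoInv n t.1 t.2.1 t.2.2.1) (rhoInv n t.1 t.2.1 t.2.2.2) t.2.1)

/-- The generating relations for the equivalence defining U_n:
(i,j,k,l) ~ (j,i,k,l), (i,j,k,l) ~ (i,j,l,k), (i,j,k,l) ~ (k,l,i,j). -/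
inductive URel : ℕ × ℕ × ℕ × ℕ → ℕ × ℕ × ℕ × ℕ → Prop
  | swapFirst (i j k l : ℕ) : URel (i, j, k, l) (j, i, k, l)
  | swapSecond (i j k l : ℕ) : URel (i, j, k, l) (i, j, l, k)
  | exchange (i j k l : ℕ) : URel (i, j, k, l) (k, l, i, j)

/-- t is a 4-tuple of pairwise distinct elements of {1,...,n}. -/
def distinct4 (n : ℕ) (t : ℕ × ℕ × ℕ × ℕ) : Prop :=
  (t.1 ∈ Set.Icc 1 n) ∧ (t.2.1 ∈ Set.Icc 1 n) ∧ (t.2.2.1 ∈ Set.Icc 1 n) ∧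
    (t.2.2.2 ∈ Set.Icc 1 n) ∧
  t.1 ≠ t.2.1 ∧ t.1 ≠ t.2.2.1 ∧ t.1 ≠ t.2.2.2 ∧
    t.2.1 ≠ t.2.2.1 ∧ t.2.1 ≠ t.2.2.2 ∧ t.2.2.1 ≠ t.2.2.2

/-- The representative of φ(a,b,c,d) ∈ U_n, namely (a, b, ρ_{a,b}⁻¹(c), ρ_{a,b}⁻¹(d));
φ itself is the class of this tuple modulo the equivalence generated by URel. -/
noncomputable def phiRep (n : ℕ) (t : ℕ × ℕ × ℕ × ℕ) : ℕ × ℕ × ℕ × ℕ :=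
  (t.1, t.2.1, rhoInv n t.1 t.2.1 t.2.2.1, rhoInv n t.1 t.2.1 t.2.2.2)

lemma rho_fst (n i j : ℕ) : rho n i j i = n - 1 := by simp [rho]

lemma rho_snd {n i j : ℕ} (hij : i < j) : rho n i j j = n := by
  simp [rho, hij.ne']

lemma rho_of_ne {n i j x : ℕ} (hi : x ≠ i) (hj : x ≠ j) : rho n i j x = x - eps i j x := by
  simp [rho, hi, hj]

lemma rho_mem {n i j x : ℕ} (hi : 1 ≤ i) (hij : i < j) (hj : j ≤ n) (hx : 1 ≤ x) (hxn : x ≤ n)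
    (hxi : x ≠ i) (hxj : x ≠ j) : 1 ≤ rho n i j x ∧ rho n i j x ≤ n - 2 := by
  rw [rho_of_ne hxi hxj, eps]
  split_ifs <;> omega

lemma rho_lt_rho_iff {n i j x y : ℕ} (hi : 1 ≤ i) (hij : i < j)
    (hxi : x ≠ i) (hxj : x ≠ j) (hyi : y ≠ i) (hyj : y ≠ j) :
    rho n i j x < rho n i j y ↔ x < y := by
  rw [rho_of_ne hxi hxj, rho_of_ne hyi hyj, eps, eps]
  split_ifs <;> omega

lemma rho_ne_rho {n i j x y : ℕ} (hi : 1 ≤ i) (hij : i < j)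
    (hxi : x ≠ i) (hxj : x ≠ j) (hyi : y ≠ i) (hyj : y ≠ j) (hxy : x ≠ y) :
    rho n i j x ≠ rho n i j y := by
  have h := rho_lt_rho_iff (n := n) hi hij hxi hxj hyi hyj
  have h' := rho_lt_rho_iff (n := n) hi hij hyi hyj hxi hxj
  omega

/-- Away from `i, j, k, l`, applying `rho` twice subtracts both shifts. -/
lemma rho_rho_of_ne {m n i j k l x : ℕ} (hi : 1 ≤ i) (hij : i < j)
    (hik : i ≠ k) (hil : i ≠ l) (hjk : j ≠ k) (hjl : j ≠ l)
    (hxi : x ≠ i) (hxj : x ≠ j) (hxk : x ≠ k) (hxl : x ≠ l) :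
    rho m (rho n i j k) (rho n i j l) (rho n i j x) = x - eps i j x - eps k l x := by
  rw [rho_of_ne (rho_ne_rho hi hij hxi hxj hik.symm hjk.symm hxk)
    (rho_ne_rho hi hij hxi hxj hil.symm hjl.symm hxl)]
  simp only [eps, rho_lt_rho_iff hi hij hxi hxj hik.symm hjk.symm,
    rho_lt_rho_iff hi hij hxi hxj hil.symm hjl.symm]
  rw [rho_of_ne hxi hxj, eps]

lemma rhoE_of_mem {n i j x : ℕ} (hx : 1 ≤ x ∧ x ≤ n) : rhoE n i j x = rho n i j x := if_pos hx

lemma rhoE_of_notMem {n i j x : ℕ} (hx : ¬(1 ≤ x ∧ x ≤ n)) : rhoE n i j x = x := if_neg hx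

/-- with i′ = ρ^n_{k,l}(i), j′ = ρ^n_{k,l}(j), k′ = ρ^n_{i,j}(k),
l′ = ρ^n_{i,j}(l) we have i′ < j′ ≤ n−2, k′ < l′ ≤ n−2, and
ρ^{n−2}_{k′,l′} ∘ ρ^n_{i,j} = (n−1, n−3)(n−2, n) ∘ ρ^{n−2}_{i′,j′} ∘ ρ^n_{k,l} in S_n. -/
theorem stmt4 (n i j k l : ℕ) (hn : 4 ≤ n)
    (hi : 1 ≤ i) (hij : i < j) (hj : j ≤ n)
    (hk : 1 ≤ k) (hkl : k < l) (hl : l ≤ n)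
    (hik : i ≠ k) (hil : i ≠ l) (hjk : j ≠ k) (hjl : j ≠ l) :
    rho n k l i < rho n k l j ∧ rho n k l j ≤ n - 2 ∧
    rho n i j k < rho n i j l ∧ rho n i j l ≤ n - 2 ∧
    rhoE (n - 2) (rho n i j k) (rho n i j l) ∘ rhoE n i j =
      ⇑(Equiv.swap (n - 1) (n - 3)) ∘ ⇑(Equiv.swap (n - 2) n) ∘
        rhoE (n - 2) (rho n k l i) (rho n k l j) ∘ rhoE n k l := by
  have mi := rho_mem hk hkl hl hi (by omega) hik hil
  have mj := rho_mem hk hkl hl (by omega) hj hjk hjl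
  have mk := rho_mem hi hij hj hk (by omega) hik.symm hjk.symm
  have ml := rho_mem hi hij hj (by omega) hl hil.symm hjl.symm
  have hij' := (rho_lt_rho_iff (n := n) hk hkl hik hil hjk hjl).2 hij
  have hkl' := (rho_lt_rho_iff (n := n) hi hij hik.symm hjk.symm hil.symm hjl.symm).2 hkl
  refine ⟨hij', mj.2, hkl', ml.2, funext fun x => ?_⟩
  simp only [Function.comp_apply]
  by_cases hx : 1 ≤ x ∧ x ≤ n
  · rw [rhoE_of_mem hx, rhoE_of_mem hx]
    by_cases hxi : x = i
    · subst hxi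
      rw [rho_fst, rhoE_of_notMem (by omega), rhoE_of_mem mi, rho_fst]
      simp only [Equiv.swap_apply_def]
      grind
    by_cases hxj : x = j
    · subst hxj
      rw [rho_snd hij, rhoE_of_notMem (by omega), rhoE_of_mem mj, rho_snd hij']
      simp only [Equiv.swap_apply_def]
      grind
    by_cases hxk : x = k
    · subst hxk
      rw [rho_fst, rhoE_of_mem mk, rho_fst, rhoE_of_notMem (by omega)]
      simp only [Equiv.swap_apply_def]
      grind
    by_cases hxl : x = l
    · subst hxl
      rw [rho_snd hkl, rhoE_of_mem ml, rho_snd hkl', rhoE_of_notMem (by omega)]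
      simp only [Equiv.swap_apply_def]
      grind
    have mx := rho_mem hi hij hj hx.1 hx.2 hxi hxj
    have mx' := rho_mem hk hkl hl hx.1 hx.2 hxk hxl
    have bound := rho_mem mi.1 hij' mj.2 mx'.1 mx'.2
      (rho_ne_rho hk hkl hxk hxl hik hil hxi) (rho_ne_rho hk hkl hxk hxl hjk hjl hxj)
    rw [rhoE_of_mem mx, rhoE_of_mem mx', Equiv.swap_apply_of_ne_of_ne (a := n - 2) (by omega)
      (by omega), Equiv.swap_apply_of_ne_of_ne (by omega) (by omega),
      rho_rho_of_ne hi hij hik hil hjk hjl hxi hxj hxk hxl,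
      rho_rho_of_ne hk hkl hik.symm hjk.symm hil.symm hjl.symm hxk hxl hxi hxj,
      Nat.sub_right_comm]
  · have hx' : ¬(1 ≤ x ∧ x ≤ n - 2) := by omega
    rw [rhoE_of_notMem hx, rhoE_of_notMem hx, rhoE_of_notMem hx', rhoE_of_notMem hx',
      Equiv.swap_apply_of_ne_of_ne (a := n - 2) (by omega) (by omega),
      Equiv.swap_apply_of_ne_of_ne (by omega) (by omega)]
end

section
/- Let n ≥ 4. Then ι_n ∘ ι_n is the identity map of O_n, and ι_n has no fixed points: ι_n(a,b,c,d) ≠ (a,b,c,d) for every (a,b,c,d) ∈ O_n. -/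
theorem rho_injOn {n i j : ℕ} (hi : 1 ≤ i) (hij : i < j) (hj : j ≤ n) :
    Set.InjOn (rho n i j) (Set.Icc 1 n) := by
  rintro x ⟨hx, hx'⟩ y ⟨hy, hy'⟩ h
  simp only [rho, eps] at h
  split_ifs at h <;> omega

theorem rhoInv_rho {n i j k : ℕ} (hi : 1 ≤ i) (hij : i < j) (hj : j ≤ n) (hk : 1 ≤ k)
    (hkn : k ≤ n) : rhoInv n i j (rho n i j k) = k :=
  (rho_injOn hi hij hj).leftInvOn_invFunOn ⟨hk, hkn⟩

theorem exists_rho_eq {n i j c : ℕ} (hi : 1 ≤ i) (hij : i < j) (hj : j ≤ n) (hc : 1 ≤ c)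
    (hcn : c ≤ n - 2) : ∃ k, 1 ≤ k ∧ k ≤ n ∧ k ≠ i ∧ k ≠ j ∧ rho n i j k = c := by
  refine ⟨if c < i then c else if c + 1 < j then c + 1 else c + 2, ?_⟩
  simp only [rho, eps]
  grind

/-- Off `{i, j}`, the map `ρ_{i,j}` reflects the order. -/
theorem lt_of_rho_lt_rho {n i j k l : ℕ} (hij : i < j) (hki : k ≠ i) (hkj : k ≠ j)
    (hli : l ≠ i) (hlj : l ≠ j) (h : rho n i j k < rho n i j l) : k < l := by
  simp only [rho, eps, hki, hkj, hli, hlj, if_false] at h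
  split_ifs at h <;> omega

/-- ι_n ∘ ι_n is the identity of O_n and ι_n has no fixed points. -/
theorem stmt7 (n : ℕ) (hn : 4 ≤ n) (a b c d : ℕ) (h : memO n a b c d) :
    iota n (iota n (a, b, c, d)) = (a, b, c, d) ∧ iota n (a, b, c, d) ≠ (a, b, c, d) := by
  obtain ⟨ha, hab, hb, hc, hcd, hd⟩ := h
  obtain ⟨k, hk, hkn, hka, hkb, rfl⟩ := exists_rho_eq ha hab hb hc (by omega : c ≤ n - 2)
  obtain ⟨l, hl, hln, hla, hlb, rfl⟩ := exists_rho_eq ha hab hb (by omega : 1 ≤ d) hd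
  have hkl := lt_of_rho_lt_rho hab hka hkb hla hlb hcd
  have key : iota n (a, b, rho n a b k, rho n a b l) = (k, l, rho n k l a, rho n k l b) := by
    simp only [iota, rhoInv_rho ha hab hb hk hkn, rhoInv_rho ha hab hb hl hln]
  refine ⟨?_, fun h => hka ?_⟩
  · rw [key]
    simp only [iota, rhoInv_rho hk hkl hln ha (hab.le.trans hb),
      rhoInv_rho hk hkl hln (ha.trans hab.le) hb]
  · rw [key] at h
    exact congrArg Prod.fst h
end

section
/- Let n ≥ 0 and m ≥ 4, and define p_n : O_m → O_{n+m} by p_n(a,b,c,d) = (a+n, b+n, c+n, d+n). Then p_n ∘ ι_m = ι_{n+m} ∘ p_n as maps O_m → O_{n+m}. -/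
lemma rhoInv_eq {n i j c : ℕ} (hi : 1 ≤ i) (hij : i < j) (hj : j ≤ n) (hc : 1 ≤ c)
    (hcn : c ≤ n - 2) :
    rhoInv n i j c = if c < i then c else if c + 1 < j then c + 1 else c + 2 := by
  have hex : ∃ k ∈ Set.Icc 1 n, rho n i j k = c := by
    refine ⟨if c < i then c else if c + 1 < j then c + 1 else c + 2, ?_, ?_⟩
    · rw [Set.mem_Icc]
      split_ifs <;> omega
    · unfold rho eps
      split_ifs <;> omega
  have hmem : rhoInv n i j c ∈ Set.Icc 1 n := Function.invFunOn_mem hex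
  have hval : rho n i j (rhoInv n i j c) = c := Function.invFunOn_eq hex
  rw [Set.mem_Icc] at hmem
  generalize rhoInv n i j c = k at hmem hval
  unfold rho eps at hval
  split_ifs at hval ⊢ <;> omega

lemma rho_add {m i j : ℕ} (n k : ℕ) (hi : 1 ≤ i) (hij : i < j) (hm : 1 ≤ m) :
    rho (n + m) (i + n) (j + n) (k + n) = rho m i j k + n := by
  unfold rho eps
  split_ifs <;> omega

lemma rhoInv_add {m i j c : ℕ} (n : ℕ) (hi : 1 ≤ i) (hij : i < j) (hj : j ≤ m) (hc : 1 ≤ c)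
    (hcm : c ≤ m - 2) :
    rhoInv (n + m) (i + n) (j + n) (c + n) = rhoInv m i j c + n := by
  rw [rhoInv_eq hi hij hj hc hcm, rhoInv_eq (by omega) (by omega) (by omega) (by omega) (by omega)]
  split_ifs <;> omega

/-- with p_n(a,b,c,d) = (a+n, b+n, c+n, d+n) : O_m → O_{n+m},
one has p_n ∘ ι_m = ι_{n+m} ∘ p_n. -/
theorem stmt8 (n m : ℕ) (hm : 4 ≤ m) (a b c d : ℕ) (h : memO m a b c d) :
    ((iota m (a, b, c, d)).1 + n, (iota m (a, b, c, d)).2.1 + n,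
      (iota m (a, b, c, d)).2.2.1 + n, (iota m (a, b, c, d)).2.2.2 + n) =
    iota (n + m) (a + n, b + n, c + n, d + n) := by
  obtain ⟨ha, hab, hb, hc, hcd, hd⟩ := h
  have hcm : c ≤ m - 2 := by omega
  have hd1 : 1 ≤ d := by omega
  have hk : 1 ≤ rhoInv m a b c := by
    rw [rhoInv_eq ha hab hb hc hcm]
    split_ifs <;> omega
  have hkl : rhoInv m a b c < rhoInv m a b d := by
    rw [rhoInv_eq ha hab hb hc hcm, rhoInv_eq ha hab hb hd1 hd]
    split_ifs <;> omega
  simp only [iota, rhoInv_add n ha hab hb hc hcm, rhoInv_add n ha hab hb hd1 hd,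
    rho_add n _ hk hkl (by omega : 1 ≤ m)]
end

section
/- Let n ≥ 4. Then the map φ : O_n → U_n is surjective, and for every u ∈ U_n the fiber φ^{-1}(u) contains exactly two elements of O_n. -/
theorem rho_lt_rho {n a b k l : ℕ} (hab : a < b) (hka : k ≠ a) (hkb : k ≠ b)
    (hla : l ≠ a) (hlb : l ≠ b) (hkl : k < l) : rho n a b k < rho n a b l := by
  unfold rho eps
  rw [if_neg hka, if_neg hkb, if_neg hla, if_neg hlb]
  split_ifs <;> omega

theorem rho_mem_Icc {n a b k : ℕ} (ha : 1 ≤ a) (hab : a < b) (hb : b ≤ n) (hka : k ≠ a)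
    (hkb : k ≠ b) (hk : 1 ≤ k) (hkn : k ≤ n) : 1 ≤ rho n a b k ∧ rho n a b k ≤ n - 2 := by
  unfold rho eps
  rw [if_neg hka, if_neg hkb]
  split_ifs <;> omega

theorem rho_injOn_s10 {n a b : ℕ} (ha : 1 ≤ a) (hab : a < b) (hb : b ≤ n) :
    Set.InjOn (rho n a b) (Set.Icc 1 n) := by
  intro x hx y hy hxy
  have key : ∀ z ∈ Set.Icc 1 n, (z = a ∧ rho n a b z = n - 1) ∨ (z = b ∧ rho n a b z = n) ∨
      (z ≠ a ∧ z ≠ b ∧ rho n a b z ≤ n - 2) := by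
    intro z hz
    by_cases hza : z = a
    · exact Or.inl ⟨hza, by simp [rho, hza]⟩
    by_cases hzb : z = b
    · exact Or.inr (Or.inl ⟨hzb, by rw [rho, if_neg hza, if_pos hzb]⟩)
    · exact Or.inr (Or.inr ⟨hza, hzb, (rho_mem_Icc ha hab hb hza hzb hz.1 hz.2).2⟩)
  rcases lt_trichotomy x y with h | h | h
  · by_cases hd : x ≠ a ∧ x ≠ b ∧ y ≠ a ∧ y ≠ b
    · have := rho_lt_rho (n := n) hab hd.1 hd.2.1 hd.2.2.1 hd.2.2.2 h
      omega
    · have hx' := key x hx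
      have hy' := key y hy
      omega
  · exact h
  · by_cases hd : x ≠ a ∧ x ≠ b ∧ y ≠ a ∧ y ≠ b
    · have := rho_lt_rho (n := n) hab hd.2.2.1 hd.2.2.2 hd.1 hd.2.1 h
      omega
    · have hx' := key x hx
      have hy' := key y hy
      omega

theorem rhoInv_rho_s10 {n a b k : ℕ} (ha : 1 ≤ a) (hab : a < b) (hb : b ≤ n)
    (hk : k ∈ Set.Icc 1 n) : rhoInv n a b (rho n a b k) = k :=
  (rho_injOn_s10 ha hab hb).leftInvOn_invFunOn hk

theorem exists_rho_eq_s10 {n a b c : ℕ} (ha : 1 ≤ a) (hab : a < b) (hb : b ≤ n)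
    (hc : 1 ≤ c) (hcn : c ≤ n - 2) :
    ∃ k ∈ Set.Icc 1 n, k ≠ a ∧ k ≠ b ∧ rho n a b k = c := by
  refine ⟨if c < a then c else if c + 1 < b then c + 1 else c + 2, ?_⟩
  unfold rho eps
  split_ifs <;> simp only [Set.mem_Icc] <;> omega

/-- Normalized representatives: `t` has distinct entries in `{1, ..., n}` and both of its pairs
are increasing. -/
def IsOrdered (n : ℕ) (t : ℕ × ℕ × ℕ × ℕ) : Prop :=
  distinct4 n t ∧ t.1 < t.2.1 ∧ t.2.2.1 < t.2.2.2

/-- The inverse of `phiRep`, from normalized representatives to `O_n`. -/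
def orderedToO (n : ℕ) (t : ℕ × ℕ × ℕ × ℕ) : ℕ × ℕ × ℕ × ℕ :=
  (t.1, t.2.1, rho n t.1 t.2.1 t.2.2.1, rho n t.1 t.2.1 t.2.2.2)

theorem memO_orderedToO {n : ℕ} {t : ℕ × ℕ × ℕ × ℕ} (ht : IsOrdered n t) :
    memO n (orderedToO n t).1 (orderedToO n t).2.1 (orderedToO n t).2.2.1
      (orderedToO n t).2.2.2 := by
  obtain ⟨i, j, k, l⟩ := t
  obtain ⟨⟨hi, hj, hk, hl, -, hik, hil, hjk, hjl, -⟩, hij, hkl⟩ := ht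
  exact ⟨hi.1, hij, hj.2, (rho_mem_Icc hi.1 hij hj.2 hik.symm hjk.symm hk.1 hk.2).1,
    rho_lt_rho hij hik.symm hjk.symm hil.symm hjl.symm hkl,
    (rho_mem_Icc hi.1 hij hj.2 hil.symm hjl.symm hl.1 hl.2).2⟩

theorem phiRep_orderedToO {n : ℕ} {t : ℕ × ℕ × ℕ × ℕ} (ht : IsOrdered n t) :
    phiRep n (orderedToO n t) = t := by
  obtain ⟨i, j, k, l⟩ := t
  obtain ⟨⟨hi, hj, hk, hl, -⟩, hij, -⟩ := ht
  simp only [phiRep, orderedToO]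
  rw [rhoInv_rho_s10 hi.1 hij hj.2 hk, rhoInv_rho_s10 hi.1 hij hj.2 hl]

theorem exists_orderedToO_eq {n a b c d : ℕ} (h : memO n a b c d) :
    ∃ t, IsOrdered n t ∧ orderedToO n t = (a, b, c, d) := by
  obtain ⟨ha, hab, hb, hc, hcd, hd⟩ := h
  obtain ⟨k, hk, hka, hkb, rfl⟩ := exists_rho_eq_s10 ha hab hb hc (by omega)
  obtain ⟨l, hl, hla, hlb, rfl⟩ := exists_rho_eq_s10 ha hab hb (by omega) hd
  have hkl : k < l := by
    rcases lt_trichotomy k l with h | h | h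
    · exact h
    · subst h
      omega
    · have := rho_lt_rho (n := n) hab hla hlb hka hkb h
      omega
  refine ⟨(a, b, k, l), ⟨⟨⟨ha, hab.le.trans hb⟩, ⟨ha.trans hab.le, hb⟩, hk, hl, ?_⟩, hab, hkl⟩, rfl⟩
  exact ⟨hab.ne, hka.symm, hla.symm, hkb.symm, hlb.symm, hkl.ne⟩

/-- The unordered pair of unordered pairs underlying a 4-tuple. -/
def pairOfPairs (t : ℕ × ℕ × ℕ × ℕ) : Sym2 (Sym2 ℕ) := s(s(t.1, t.2.1), s(t.2.2.1, t.2.2.2))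

theorem pairOfPairs_eq_of_eqvGen {t u : ℕ × ℕ × ℕ × ℕ} (h : Relation.EqvGen URel t u) :
    pairOfPairs t = pairOfPairs u := by
  induction h with
  | rel x y h =>
    cases h with
    | swapFirst i j k l => simp only [pairOfPairs, Sym2.eq_swap (a := i)]
    | swapSecond i j k l => simp only [pairOfPairs, Sym2.eq_swap (a := k)]
    | exchange i j k l => exact Sym2.eq_swap
  | refl x => rfl
  | symm x y _ ih => exact ih.symm
  | trans x y z _ _ ih₁ ih₂ => exact ih₁.trans ih₂

/-- Exchange the two pairs of a 4-tuple. -/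
def exchangePairs (t : ℕ × ℕ × ℕ × ℕ) : ℕ × ℕ × ℕ × ℕ := (t.2.2.1, t.2.2.2, t.1, t.2.1)

theorem IsOrdered.exchangePairs {n : ℕ} {t : ℕ × ℕ × ℕ × ℕ} (ht : IsOrdered n t) :
    IsOrdered n (exchangePairs t) := by
  obtain ⟨⟨hi, hj, hk, hl, hij', hik, hil, hjk, hjl, hkl'⟩, hij, hkl⟩ := ht
  exact ⟨⟨hk, hl, hi, hj, hkl', hik.symm, hjk.symm, hil.symm, hjl.symm, hij'⟩, hkl, hij⟩

theorem IsOrdered.eqvGen_iff {n : ℕ} {t u : ℕ × ℕ × ℕ × ℕ} (ht : IsOrdered n t)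
    (hu : IsOrdered n u) : Relation.EqvGen URel t u ↔ t = u ∨ t = _root_.exchangePairs u := by
  constructor
  · intro h
    have h := pairOfPairs_eq_of_eqvGen h
    obtain ⟨i, j, k, l⟩ := t
    obtain ⟨i', j', k', l'⟩ := u
    obtain ⟨-, hij, hkl⟩ := ht
    obtain ⟨-, hij', hkl'⟩ := hu
    simp only [pairOfPairs, Sym2.eq_iff] at h
    simp only [_root_.exchangePairs, Prod.mk.injEq]
    simp only at hij hkl hij' hkl'
    omega
  · rintro (rfl | rfl)
    · exact .refl _
    · exact .rel _ _ (.exchange _ _ _ _)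

theorem exists_isOrdered_eqvGen {n : ℕ} {t : ℕ × ℕ × ℕ × ℕ} (ht : distinct4 n t) :
    ∃ u, IsOrdered n u ∧ Relation.EqvGen URel u t := by
  obtain ⟨i, j, k, l⟩ := t
  obtain ⟨hi, hj, hk, hl, hij, hik, hil, hjk, hjl, hkl⟩ := ht
  rcases lt_or_gt_of_ne hij with h | h <;> rcases lt_or_gt_of_ne hkl with h' | h'
  · exact ⟨(i, j, k, l), ⟨⟨hi, hj, hk, hl, hij, hik, hil, hjk, hjl, hkl⟩, h, h'⟩, .refl _⟩
  · exact ⟨(i, j, l, k), ⟨⟨hi, hj, hl, hk, hij, hil, hik, hjl, hjk, hkl.symm⟩, h, h'⟩,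
      .rel _ _ (.swapSecond _ _ _ _)⟩
  · exact ⟨(j, i, k, l), ⟨⟨hj, hi, hk, hl, hij.symm, hjk, hjl, hik, hil, hkl⟩, h, h'⟩,
      .rel _ _ (.swapFirst _ _ _ _)⟩
  · exact ⟨(j, i, l, k), ⟨⟨hj, hi, hl, hk, hij.symm, hjl, hjk, hil, hik, hkl.symm⟩, h, h'⟩,
      .trans _ _ _ (.rel _ _ (.swapFirst _ _ _ _)) (.rel _ _ (.swapSecond _ _ _ _))⟩

/-- φ : O_n → U_n is surjective and each fiber has exactly two elements. -/
theorem stmt10 (n : ℕ) (hn : 4 ≤ n) :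
    (∀ t : ℕ × ℕ × ℕ × ℕ, distinct4 n t →
      ∃ a b c d, memO n a b c d ∧ Relation.EqvGen URel (phiRep n (a, b, c, d)) t) ∧
    (∀ a b c d, memO n a b c d →
      Set.ncard {o : ℕ × ℕ × ℕ × ℕ | memO n o.1 o.2.1 o.2.2.1 o.2.2.2 ∧
        Relation.EqvGen URel (phiRep n o) (phiRep n (a, b, c, d))} = 2) := by
  refine ⟨fun t ht ↦ ?_, fun a b c d h ↦ ?_⟩
  · obtain ⟨u, hu, hut⟩ := exists_isOrdered_eqvGen ht
    refine ⟨_, _, _, _, memO_orderedToO hu, ?_⟩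
    change Relation.EqvGen URel (phiRep n (orderedToO n u)) t
    rwa [phiRep_orderedToO hu]
  · obtain ⟨t, ht, hto⟩ := exists_orderedToO_eq h
    rw [Set.ncard_eq_two]
    refine ⟨orderedToO n t, orderedToO n (exchangePairs t), fun heq ↦ ?_, ?_⟩
    · exact ht.1.2.2.2.2.2.1 (congrArg Prod.fst heq)
    · rw [← hto, phiRep_orderedToO ht]
      ext o
      simp only [Set.mem_ofPred_eq, Set.mem_insert_iff, Set.mem_singleton_iff]
      constructor
      · rintro ⟨ho, hot⟩
        obtain ⟨u, hu, huo⟩ := exists_orderedToO_eq ho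
        change orderedToO n u = o at huo
        subst huo
        rw [phiRep_orderedToO hu, hu.eqvGen_iff ht] at hot
        exact hot.imp (congrArg _) (congrArg _)
      · rintro (rfl | rfl)
        · exact ⟨memO_orderedToO ht, by rw [phiRep_orderedToO ht]; exact .refl _⟩
        · refine ⟨memO_orderedToO ht.exchangePairs, ?_⟩
          rw [phiRep_orderedToO ht.exchangePairs, ht.exchangePairs.eqvGen_iff ht]
          exact Or.inr rfl
end

section
/- Let n ≥ 2, m ≥ 0, let 1 ≤ i < j ≤ n and 1 ≤ k < l ≤ n, let τ ∈ S_n, and let σ ∈ S_{n−2}, regarded as an element of S_n fixing n−1 and n. If ρ^n_{i,j} ∘ τ = σ ∘ ρ^n_{k,l} in S_n, then in S_{n+m} one has ρ^{n+m}_{i,j} ∘ (τ × id_m) = σ′ ∘ ρ^{n+m}_{k,l}, where τ × id_m ∈ S_{n+m} is the block permutation acting by τ on {1,...,n} and fixing {n+1,...,n+m}, and σ′ ∈ S_{n+m} is the permutation acting by σ on {1,...,n−2} and fixing {n−1,...,n+m} pointwise. -/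
/-- Away from `i` and `j`, the map `rho n i j` takes values in `{1, ..., n - 2}`. -/
lemma sub_eps_mem_Icc {n i j x : ℕ} (hi : 1 ≤ i) (hij : i < j) (hj : j ≤ n)
    (hx : 1 ≤ x) (hxn : x ≤ n) (hxi : x ≠ i) (hxj : x ≠ j) :
    x - eps i j x ∈ Set.Icc 1 (n - 2) := by
  simp only [eps, Set.mem_Icc]
  split_ifs <;> omega

/-- if ρ^n_{i,j} ∘ τ = σ ∘ ρ^n_{k,l} in S_n (τ ∈ S_n, σ ∈ S_{n−2} ⊂ S_n),
then ρ^{n+m}_{i,j} ∘ (τ × id_m) = σ′ ∘ ρ^{n+m}_{k,l} in S_{n+m}.  Here permutations are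
realized as maps ℕ → ℕ which are the identity off their support, so that
τ × id_m coincides with τ and σ′ coincides with σ as maps ℕ → ℕ. -/
theorem stmt14 (n m i j k l : ℕ) (hn : 2 ≤ n)
    (hi : 1 ≤ i) (hij : i < j) (hj : j ≤ n)
    (hk : 1 ≤ k) (hkl : k < l) (hl : l ≤ n)
    (τ σ : ℕ → ℕ) (hτ : PermOn (Set.Icc 1 n) τ) (hσ : PermOn (Set.Icc 1 (n - 2)) σ)
    (h : rhoE n i j ∘ τ = σ ∘ rhoE n k l) :
    rhoE (n + m) i j ∘ τ = σ ∘ rhoE (n + m) k l := by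
  obtain ⟨hσb, hσf⟩ := hσ
  obtain ⟨hτb, hτf⟩ := hτ
  have hfix : ∀ y, n - 2 < y → σ y = y := fun y hy => hσf y fun hy' => by
    have := hy'.2
    omega
  funext x
  have hx := congrFun h x
  simp only [Function.comp_apply] at hx ⊢
  by_cases hxn : x ∈ Set.Icc 1 n
  · obtain ⟨hy1, hyn⟩ := hτb.mapsTo hxn
    obtain ⟨hx1, hxn⟩ := hxn
    have hy := sub_eps_mem_Icc hi hij hj hy1 hyn
    have hz := sub_eps_mem_Icc hk hkl hl hx1 hxn
    have hs : x ≠ k → x ≠ l → σ (x - eps k l x) ∈ Set.Icc 1 (n - 2) :=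
      fun h₁ h₂ => hσb.mapsTo (hz h₁ h₂)
    have e₁ := hfix (n - 1) (by omega)
    have e₂ := hfix n (by omega)
    have e₃ := hfix (n + m - 1) (by omega)
    have e₄ := hfix (n + m) (by omega)
    simp only [Set.mem_Icc] at hy hs
    simp only [rhoE, rho, hx1, hxn, hy1, hyn, true_and, if_true,
      show x ≤ n + m by omega, show τ x ≤ n + m by omega] at hx ⊢
    grind
  · have e := hτf x hxn
    simp only [Set.mem_Icc] at hxn
    rw [e]
    rcases Nat.eq_zero_or_pos x with rfl | hx1
    · simpa [rhoE] using (hσf 0 (by simp)).symm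
    · have e₁ := hfix x (by omega)
      have e₂ := hfix (x - 2) (by omega)
      simp only [rhoE, rho, eps]
      split_ifs <;> omega
end

section
/- Let n ≥ 4 and let σ ∈ S_{n−2}, 1 ≤ i < j ≤ n, τ ∈ S_{n−2}, 1 ≤ k < l ≤ n, where S_{n−2} is regarded as the subgroup of S_n fixing n−1 and n. If (σ ∘ ρ_{i,j}) ∘ (τ ∘ ρ_{k,l})^{-1} lies in the subgroup of S_n generated by the transposition (n−1, n), then σ = τ, i = k, and j = l. -/
theorem PermOn.apply_le_iff {m : ℕ} {f : ℕ → ℕ} (hf : PermOn (Set.Icc 1 m) f) (z : ℕ) :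
    f z ≤ m ↔ z ≤ m := by
  by_cases hz : z ∈ Set.Icc 1 m
  · exact iff_of_true (hf.1.mapsTo hz).2 hz.2
  · rw [hf.2 z hz]

theorem swap_apply_eq_self_of_le {n z : ℕ} (hn : 2 ≤ n) (hz : z ≤ n - 2) :
    Equiv.swap (n - 1) n z = z :=
  Equiv.swap_apply_of_ne_of_ne (by omega) (by omega)

theorem swap_apply_le_iff {n : ℕ} (hn : 2 ≤ n) (z : ℕ) :
    Equiv.swap (n - 1) n z ≤ n - 2 ↔ z ≤ n - 2 := by
  rw [Equiv.swap_apply_def]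
  split_ifs <;> omega

theorem rhoE_le_iff {n i j x : ℕ} (hn : 2 ≤ n) (hij : i < j) (hj : j ≤ n) (hx : x ∈ Set.Icc 1 n) :
    rhoE n i j x ≤ n - 2 ↔ x ≠ i ∧ x ≠ j := by
  obtain ⟨hx1, hxn⟩ := hx
  unfold rhoE rho eps
  split_ifs <;> omega

theorem exists_rhoE_eq {n i j y : ℕ} (hij : i < j) (hy : y ∈ Set.Icc 1 (n - 2)) :
    ∃ x, rhoE n i j x = y := by
  obtain ⟨hy1, hyn⟩ := hy
  by_cases h1 : y < i
  · exact ⟨y, by unfold rhoE rho eps; split_ifs <;> omega⟩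
  by_cases h2 : y + 1 < j
  · exact ⟨y + 1, by unfold rhoE rho eps; split_ifs <;> omega⟩
  · exact ⟨y + 2, by unfold rhoE rho eps; split_ifs <;> omega⟩

/-- if (σ ∘ ρ_{i,j}) ∘ (τ ∘ ρ_{k,l})⁻¹ lies in the subgroup generated by
the transposition (n−1, n) — equivalently σ ∘ ρ_{i,j} equals τ ∘ ρ_{k,l} or
(n−1, n) ∘ τ ∘ ρ_{k,l} — then σ = τ, i = k and j = l. -/
theorem stmt15 (n : ℕ) (hn : 4 ≤ n) (σ τ : ℕ → ℕ)
    (hσ : PermOn (Set.Icc 1 (n - 2)) σ) (hτ : PermOn (Set.Icc 1 (n - 2)) τ)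
    (i j k l : ℕ) (hi : 1 ≤ i) (hij : i < j) (hj : j ≤ n)
    (hk : 1 ≤ k) (hkl : k < l) (hl : l ≤ n)
    (h : σ ∘ rhoE n i j = τ ∘ rhoE n k l ∨
      σ ∘ rhoE n i j = ⇑(Equiv.swap (n - 1) n) ∘ τ ∘ rhoE n k l) :
    σ = τ ∧ i = k ∧ j = l := by
  have hn2 : 2 ≤ n := by omega
  have hle : ∀ x, σ (rhoE n i j x) ≤ n - 2 ↔ τ (rhoE n k l x) ≤ n - 2 := by
    intro x
    rcases h with h | h
    · rw [show σ (rhoE n i j x) = τ (rhoE n k l x) from congrFun h x]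
    · rw [show σ (rhoE n i j x) = Equiv.swap (n - 1) n (τ (rhoE n k l x)) from congrFun h x,
        swap_apply_le_iff hn2]
  have hpair : ∀ x ∈ Set.Icc 1 n, (x ≠ i ∧ x ≠ j) ↔ (x ≠ k ∧ x ≠ l) := by
    intro x hx
    rw [← rhoE_le_iff hn2 hij hj hx, ← rhoE_le_iff hn2 hkl hl hx,
      ← hσ.apply_le_iff (rhoE n i j x), ← hτ.apply_le_iff (rhoE n k l x), hle]
  have h_i := hpair i ⟨by omega, by omega⟩
  have h_j := hpair j ⟨by omega, by omega⟩
  obtain ⟨rfl, rfl⟩ : i = k ∧ j = l := by omega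
  refine ⟨funext fun y => ?_, rfl, rfl⟩
  by_cases hy : y ∈ Set.Icc 1 (n - 2)
  · obtain ⟨x, rfl⟩ := exists_rhoE_eq hij hy
    rcases h with h | h
    · exact congrFun h x
    · exact (congrFun h x).trans (swap_apply_eq_self_of_le hn2 (hτ.1.mapsTo hy).2)
  · rw [hσ.2 y hy, hτ.2 y hy]
end
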